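/- arXiv:2302.11295 — 2 statements merged into one kernel-verified Lean document; each statement's English description precedes it below -/
import Mathlib

section
/- Let G be a bipartite graph on n vertices with m edges whose vertices are colored with two colors in ratio 1:1, and let ν be the maximum cardinality of a matching in G all of whose edges join two vertices of different colors. Then the minimum correlation clustering cost over all fair partitions of the vertex set of G equals n/2 + m − 2ν. -/
open Finset

/-- Two vertices lie in a common block of the clustering `P`. -/
def SameBlock {V : Type*} (P : Finset (Finset V)) (u v : V) : Prop :=
  ∃ S ∈ P, u ∈ S ∧ v ∈ S

/-- Inter-cluster cost: the number of edges whose endpoints lie in different blocks of `P`. -/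
noncomputable def interCost {V : Type*} (G : SimpleGraph V) (P : Finset (Finset V)) : ℕ :=
  {e : Sym2 V | e ∈ G.edgeSet ∧ ∃ u ∈ e, ∃ v ∈ e, ¬ SameBlock P u v}.ncard

/-- Intra-cluster cost: the number of non-adjacent pairs of distinct vertices lying in a
common block of `P`. -/
noncomputable def intraCost {V : Type*} (G : SimpleGraph V) (P : Finset (Finset V)) : ℕ :=
  {e : Sym2 V | ¬ e.IsDiag ∧ e ∉ G.edgeSet ∧ ∀ u ∈ e, ∀ v ∈ e, SameBlock P u v}.ncard

/-- The correlation clustering cost of a clustering `P` on the graph `G`. -/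
noncomputable def ccCost {V : Type*} (G : SimpleGraph V) (P : Finset (Finset V)) : ℕ :=
  intraCost G P + interCost G P

/-- A set `S` is fair w.r.t. the coloring `col`: for each color, the fraction of `S`
of that color equals the global fraction (stated by cross multiplication). -/
def FairSet {V : Type*} [Fintype V] {k : ℕ} (col : V → Fin k) (S : Finset V) : Prop :=
  ∀ i : Fin k,
    (S.filter fun v => col v = i).card * Fintype.card V
      = (Finset.univ.filter fun v => col v = i).card * S.card

/-- `M` is a matching in `G` all of whose edges join two vertices of different colors. -/
def IsBichromaticMatching {V : Type*} {k : ℕ} (G : SimpleGraph V) (col : V → Fin k)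
    (M : Finset (Sym2 V)) : Prop :=
  ↑M ⊆ G.edgeSet ∧
  (∀ e ∈ M, ∀ f ∈ M, e ≠ f → ∀ v : V, v ∈ e → v ∉ f) ∧
  (∀ e ∈ M, ∀ u ∈ e, ∀ v ∈ e, u ≠ v → col u ≠ col v)

/-- The unordered pairs of distinct elements of `S`. -/
def pairsIn {V : Type*} [DecidableEq V] (S : Finset V) : Finset (Sym2 V) :=
  S.offDiag.image Sym2.mk.uncurry

lemma mk_mem_pairsIn {V : Type*} [DecidableEq V] {S : Finset V} {u v : V} :
    s(u, v) ∈ pairsIn S ↔ u ∈ S ∧ v ∈ S ∧ u ≠ v := by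
  simp only [pairsIn, mem_image, mem_offDiag, Prod.exists, Function.uncurry_apply_pair, Sym2.eq_iff]
  grind

lemma card_pairsIn {V : Type*} [DecidableEq V] (S : Finset V) :
    #(pairsIn S) = (#S).choose 2 :=
  Sym2.card_image_offDiag S

/-- The unordered pairs of distinct vertices lying in a common block of `P`. -/
def blockPairs {V : Type*} [Fintype V] [DecidableEq V]
    (P : Finpartition (univ : Finset V)) : Finset (Sym2 V) :=
  P.parts.biUnion pairsIn

lemma mk_mem_blockPairs {V : Type*} [Fintype V] [DecidableEq V]
    {P : Finpartition (univ : Finset V)} {u v : V} :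
    s(u, v) ∈ blockPairs P ↔ u ≠ v ∧ SameBlock P.parts u v := by
  simp only [blockPairs, mem_biUnion, mk_mem_pairsIn, SameBlock]
  grind

lemma pairwiseDisjoint_pairsIn {V : Type*} [Fintype V] [DecidableEq V]
    (P : Finpartition (univ : Finset V)) :
    (P.parts : Set (Finset V)).PairwiseDisjoint pairsIn := by
  intro S hS T hT hST
  rw [Function.onFun, Finset.disjoint_left]
  intro e
  induction e with | _ u v
  rw [mk_mem_pairsIn, mk_mem_pairsIn]
  rintro ⟨hu, -⟩ ⟨hu', -⟩
  exact hST (P.eq_of_mem_parts hS hT hu hu')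

lemma sameBlock_self {V : Type*} [Fintype V] [DecidableEq V]
    (P : Finpartition (univ : Finset V)) (v : V) : SameBlock P.parts v v := by
  obtain ⟨S, hS, hv⟩ := P.exists_mem (mem_univ v)
  exact ⟨S, hS, hv, hv⟩

lemma sameBlock_comm {V : Type*} {P : Finset (Finset V)} {u v : V} :
    SameBlock P u v ↔ SameBlock P v u := by
  simp only [SameBlock, and_comm]

lemma ccCost_add_two_mul {V : Type*} [Fintype V] [DecidableEq V] (G : SimpleGraph V)
    [Fintype G.edgeSet] (P : Finpartition (univ : Finset V)) :
    ccCost G P.parts + 2 * #(blockPairs P ∩ G.edgeFinset)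
      = #(blockPairs P) + #G.edgeFinset := by
  have hintra : intraCost G P.parts = #(blockPairs P \ G.edgeFinset) := by
    rw [intraCost, ← Set.ncard_coe_finset]
    congr 1
    ext e
    induction e with | _ u v
    have := sameBlock_self P u
    have := sameBlock_self P v
    have := sameBlock_comm (P := P.parts) (u := u) (v := v)
    simp only [Set.mem_ofPred_eq, coe_sdiff, Set.mem_sdiff, mem_coe, mk_mem_blockPairs,
      SimpleGraph.mem_edgeFinset, Sym2.mk_isDiag_iff, Sym2.mem_iff, forall_eq_or_imp, forall_eq]
    tauto
  have hinter : interCost G P.parts = #(G.edgeFinset \ blockPairs P) := by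
    rw [interCost, ← Set.ncard_coe_finset]
    congr 1
    ext e
    induction e with | _ u v
    have := sameBlock_self P u
    have := sameBlock_self P v
    have := sameBlock_comm (P := P.parts) (u := u) (v := v)
    have : G.Adj u v → u ≠ v := SimpleGraph.Adj.ne
    simp only [Set.mem_ofPred_eq, coe_sdiff, Set.mem_sdiff, mem_coe, mk_mem_blockPairs,
      SimpleGraph.mem_edgeFinset, SimpleGraph.mem_edgeSet, Sym2.mem_iff, exists_eq_or_imp,
      exists_eq_left]
    tauto
  have h₁ := card_sdiff_add_card_inter (blockPairs P) G.edgeFinset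
  have h₂ := card_sdiff_add_card_inter G.edgeFinset (blockPairs P)
  rw [inter_comm] at h₂
  rw [ccCost, hintra, hinter]
  omega

lemma exists_injOn_color_ne {V : Type*} (col : V → Fin 2) (X Y : Finset V)
    (h : ∀ i j, i ≠ j → #{v ∈ X | col v = i} ≤ #{v ∈ Y | col v = j}) :
    ∃ f : V → V, Set.MapsTo f X Y ∧ Set.InjOn f X ∧ ∀ x ∈ X, col x ≠ col (f x) := by
  rcases isEmpty_or_nonempty V with hV | hV
  · exact ⟨id, fun x => isEmptyElim x, fun x => isEmptyElim x, fun x => isEmptyElim x⟩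
  have key (i : Fin 2) : ∃ f : V → V, (∀ x ∈ X, col x = i → f x ∈ Y ∧ col (f x) = i + 1) ∧
      Set.InjOn f {x | x ∈ X ∧ col x = i} := by
    have hle : (({v ∈ X | col v = i} : Finset V) : Set V).encard ≤
        (({v ∈ Y | col v = i + 1} : Finset V) : Set V).encard := by
      rw [Set.encard_coe_eq_coe_finsetCard, Set.encard_coe_eq_coe_finsetCard]
      exact_mod_cast h i (i + 1) (by omega)
    obtain ⟨f, hf, hinj⟩ := (Finset.finite_toSet _).exists_injOn_of_encard_le hle
    refine ⟨f, fun x hx hi => ?_, by simpa using hinj⟩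
    have := hf (show x ∈ _ by simpa using ⟨hx, hi⟩)
    simpa using this
  choose f hf hinj using key
  refine ⟨fun v => f (col v) v, fun x hx => (hf _ x hx rfl).1, fun x hx y hy hxy => ?_,
    fun x hx => ?_⟩
  · have hx' := (hf _ x hx rfl).2
    have hy' := (hf _ y hy rfl).2
    have hc : col x = col y := by
      simp only at hxy
      rw [hxy, hy'] at hx'
      exact (add_right_cancel hx').symm
    simp only [hc] at hxy
    exact hinj (col y) ⟨hx, hc⟩ ⟨hy, rfl⟩ hxy
  · have := (hf _ x hx rfl).2
    simp only [this]
    omega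

lemma IsBichromaticMatching.of_injOn {V : Type*} [DecidableEq V] {k : ℕ} {G : SimpleGraph V}
    {col : V → Fin k} {X Y : Finset V} {f : V → V} (hXY : Disjoint X Y)
    (hf : Set.MapsTo f X Y) (hinj : Set.InjOn f X) (hcol : ∀ x ∈ X, col x ≠ col (f x))
    (hadj : ∀ x ∈ X, G.Adj x (f x)) :
    IsBichromaticMatching G col (X.image fun x => s(x, f x)) := by
  have hne : ∀ x ∈ X, ∀ y ∈ X, x ≠ f y := fun x hx y hy h =>
    Finset.disjoint_left.1 hXY hx (h ▸ hf hy)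
  refine ⟨?_, ?_, ?_⟩
  · intro e he
    obtain ⟨x, hx, rfl⟩ := mem_image.1 (mem_coe.1 he)
    exact hadj x hx
  · simp only [mem_image, forall_exists_index, and_imp, forall_apply_eq_imp_iff₂, Sym2.mem_iff]
    intro x hx y hy hxy v hv
    have hxy' : x ≠ y := by
      rintro rfl
      exact hxy rfl
    have hfxy : f x ≠ f y := fun h => hxy' (hinj hx hy h)
    have := hne x hx y hy
    have := hne y hy x hx
    grind
  · simp only [mem_image, forall_exists_index, and_imp, forall_apply_eq_imp_iff₂, Sym2.mem_iff]
    intro x hx u hu v hv huv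
    have := hcol x hx
    grind

lemma exists_matching_of_card_le {V : Type*} [DecidableEq V] (G : SimpleGraph V)
    [DecidableRel G.Adj] [Fintype G.edgeSet] (col : V → Fin 2) (X Y : Finset V) (a : ℕ)
    (hXY : Disjoint X Y) (hle : #X ≤ #Y)
    (hcard : ∀ i, #{v ∈ X | col v = i} + #{v ∈ Y | col v = i} = a)
    (hadj : ∀ u ∈ X ∪ Y, ∀ v ∈ X ∪ Y, G.Adj u v → (u ∈ X ↔ v ∈ Y)) :
    ∃ M ⊆ pairsIn (X ∪ Y), IsBichromaticMatching G col M ∧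
      #(pairsIn (X ∪ Y) ∩ G.edgeFinset) ≤ #M + a * (a - 1) := by
  have hsplit (Z : Finset V) : #{v ∈ Z | col v = 0} + #{v ∈ Z | col v = 1} = #Z := by
    rw [← card_filter_add_card_filter_not (s := Z) (fun v => col v = 0)]
    congr 3
    ext v
    omega
  have hX := hsplit X
  have hY := hsplit Y
  have h0 := hcard 0
  have h1 := hcard 1
  obtain ⟨f, hf, hinj, hcol⟩ := exists_injOn_color_ne col X Y (by
    intro i j hij
    fin_cases i <;> fin_cases j <;> simp at hij ⊢ <;> omega)
  have hsub : {x ∈ X | G.Adj x (f x)} ⊆ X := filter_subset _ _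
  refine ⟨({x ∈ X | G.Adj x (f x)} : Finset V).image fun x => s(x, f x), ?_,
    .of_injOn (disjoint_of_subset_left hsub hXY) (hf.mono_left (coe_subset.2 hsub))
      (hinj.mono (coe_subset.2 hsub)) (fun x hx => hcol x (hsub hx))
      (fun x hx => (mem_filter.1 hx).2), ?_⟩
  · intro e he
    obtain ⟨x, hx, rfl⟩ := mem_image.1 he
    have hx' := mem_filter.1 hx
    exact mk_mem_pairsIn.2 ⟨mem_union_left _ hx'.1, mem_union_right _ (hf hx'.1), hx'.2.ne⟩
  set M := ({x ∈ X | G.Adj x (f x)} : Finset V).image fun x => s(x, f x)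
  set N := (X ×ˢ Y) \ X.image (fun x => (x, f x)) with hN
  have hcover : pairsIn (X ∪ Y) ∩ G.edgeFinset ⊆ M ∪ N.image Sym2.mk.uncurry := by
    have aux : ∀ u ∈ X, ∀ v ∈ Y, G.Adj u v → s(u, v) ∈ M ∪ N.image Sym2.mk.uncurry := by
      intro u hu v hv huv
      by_cases h : v = f u
      · subst h
        exact mem_union_left _ (mem_image.2 ⟨u, mem_filter.2 ⟨hu, huv⟩, rfl⟩)
      · refine mem_union_right _ (mem_image.2 ⟨(u, v), ?_, rfl⟩)
        simp only [hN, mem_sdiff, mem_product, mem_image, Prod.mk.injEq]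
        grind
    intro e he
    induction e with | _ u v
    obtain ⟨hp, he⟩ := mem_inter.1 he
    obtain ⟨hu, hv, -⟩ := mk_mem_pairsIn.1 hp
    have huv : G.Adj u v := by simpa using he
    have h := hadj u hu v hv huv
    rcases mem_union.1 hu with hu' | hu'
    · exact aux u hu' v (h.1 hu') huv
    · have hv' : v ∈ X := (hadj v hv u hu huv.symm).2 hu'
      rw [Sym2.eq_swap]
      exact aux v hv' u hu' huv.symm
  have hNcard : #N + #X = #X * #Y := by
    rw [← card_product, ← card_sdiff_add_card_eq_card (s := X.image (fun x => (x, f x)))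
      (t := X ×ˢ Y), card_image_of_injective _ fun x y h => (Prod.mk.inj h).1]
    intro p hp
    obtain ⟨x, hx, rfl⟩ := mem_image.1 hp
    exact mem_product.2 ⟨hx, hf hx⟩
  have hbound : #N ≤ a * (a - 1) := by
    obtain ⟨d, hd⟩ : ∃ d, a = #X + d := ⟨a - #X, by omega⟩
    have hYd : #Y = #X + 2 * d := by omega
    rcases Nat.eq_zero_or_pos a with ha | ha
    · have : #X = 0 := by omega
      rw [this] at hNcard
      omega
    obtain ⟨b, rfl⟩ : ∃ b, a = b + 1 := ⟨a - 1, by omega⟩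
    rw [Nat.add_sub_cancel]
    rw [hYd] at hNcard
    rcases Nat.eq_zero_or_pos d with hd0 | hd0
    · subst hd0
      nlinarith
    · nlinarith [Nat.mul_le_mul hd0 hd0]
  calc #(pairsIn (X ∪ Y) ∩ G.edgeFinset) ≤ #(M ∪ N.image Sym2.mk.uncurry) := card_le_card hcover
    _ ≤ #M + #(N.image Sym2.mk.uncurry) := card_union_le _ _
    _ ≤ #M + a * (a - 1) := Nat.add_le_add_left (card_image_le.trans hbound) _

lemma exists_matching_of_balanced {V : Type*} [DecidableEq V] (G : SimpleGraph V)
    [DecidableRel G.Adj] [Fintype G.edgeSet] {A : Set V}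
    (hbip : ∀ u v, G.Adj u v → (u ∈ A ↔ v ∉ A)) (col : V → Fin 2) (S : Finset V) (a : ℕ)
    (hS : ∀ i, #{v ∈ S | col v = i} = a) :
    ∃ M ⊆ pairsIn S, IsBichromaticMatching G col M ∧
      #(pairsIn S ∩ G.edgeFinset) ≤ #M + a * (a - 1) := by
  classical
  have hunion : {v ∈ S | v ∈ A} ∪ {v ∈ S | v ∉ A} = S := filter_union_filter_not_eq _ S
  have hdisj : Disjoint {v ∈ S | v ∈ A} {v ∈ S | v ∉ A} := disjoint_filter_filter_not _ _ _
  have hcard (i : Fin 2) : #{v ∈ {v ∈ S | v ∈ A} | col v = i}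
      + #{v ∈ {v ∈ S | v ∉ A} | col v = i} = a := by
    rw [← hS i, ← card_filter_add_card_filter_not (s := {v ∈ S | col v = i}) (fun v => v ∈ A),
      filter_comm, filter_comm (fun v => v ∉ A)]
  rcases le_total #{v ∈ S | v ∈ A} #{v ∈ S | v ∉ A} with hle | hle
  · have := exists_matching_of_card_le G col _ _ a hdisj hle hcard (by
      rw [hunion]
      intro u hu v hv huv
      have := hbip u v huv
      simp only [mem_filter]
      tauto)
    rwa [hunion] at this
  · have := exists_matching_of_card_le G col _ _ a hdisj.symm hle
      (fun i => (add_comm _ _).trans (hcard i)) (by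
        rw [union_comm, hunion]
        intro u hu v hv huv
        have := hbip u v huv
        simp only [mem_filter]
        tauto)
    rwa [union_comm, hunion] at this

lemma IsBichromaticMatching.biUnion_parts {V : Type*} [Fintype V] [DecidableEq V] {k : ℕ}
    {G : SimpleGraph V} {col : V → Fin k} (P : Finpartition (univ : Finset V))
    {M : Finset V → Finset (Sym2 V)} (hsub : ∀ S ∈ P.parts, M S ⊆ pairsIn S)
    (hM : ∀ S ∈ P.parts, IsBichromaticMatching G col (M S)) :
    IsBichromaticMatching G col (P.parts.biUnion M) := by
  have hmem : ∀ S ∈ P.parts, ∀ e ∈ M S, ∀ v ∈ e, v ∈ S := by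
    intro S hS e he v hv
    obtain ⟨w, rfl⟩ := Sym2.mem_iff_exists.1 hv
    exact (mk_mem_pairsIn.1 (hsub S hS he)).1
  refine ⟨?_, ?_, ?_⟩
  · intro e he
    obtain ⟨S, hS, he⟩ := mem_biUnion.1 (mem_coe.1 he)
    exact (hM S hS).1 he
  · intro e he f hf hef v hve hvf
    obtain ⟨S, hS, he⟩ := mem_biUnion.1 he
    obtain ⟨T, hT, hf⟩ := mem_biUnion.1 hf
    obtain rfl := P.eq_of_mem_parts hS hT (hmem S hS e he v hve) (hmem T hT f hf v hvf)
    exact (hM S hS).2.1 e he f hf hef v hve hvf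
  · intro e he
    obtain ⟨S, hS, he⟩ := mem_biUnion.1 he
    exact (hM S hS).2.2 e he

lemma card_add_two_mul_card_edges_le_ccCost {V : Type*} [Fintype V] [DecidableEq V]
    (G : SimpleGraph V) [DecidableRel G.Adj] {A : Set V}
    (hbip : ∀ u v, G.Adj u v → (u ∈ A ↔ v ∉ A)) (col : V → Fin 2) {ν : ℕ}
    (hν : ∀ M : Finset (Sym2 V), IsBichromaticMatching G col M → #M ≤ ν)
    (P : Finpartition (univ : Finset V))
    (hP : ∀ S ∈ P.parts, ∀ i, #{v ∈ S | col v = i} * 2 = #S) :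
    Fintype.card V + 2 * #G.edgeFinset ≤ 2 * ccCost G P.parts + 4 * ν := by
  have hblock (S : Finset V) : ∃ M : Finset (Sym2 V), S ∈ P.parts → M ⊆ pairsIn S ∧
      IsBichromaticMatching G col M ∧
      #(pairsIn S ∩ G.edgeFinset) ≤ #M + (#S / 2) * (#S / 2 - 1) := by
    by_cases hS : S ∈ P.parts
    · obtain ⟨M, h⟩ := exists_matching_of_balanced G hbip col S (#S / 2) (fun i => by
        have := hP S hS i
        omega)
      exact ⟨M, fun _ => h⟩
    · exact ⟨∅, fun h => (hS h).elim⟩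
  choose M hM using hblock
  have hMν : ∑ S ∈ P.parts, #(M S) ≤ ν := by
    rw [← card_biUnion fun S hS T hT hST => disjoint_of_subset_left (hM S hS).1
      (disjoint_of_subset_right (hM T hT).1 (pairwiseDisjoint_pairsIn P hS hT hST))]
    exact hν _ (.biUnion_parts P (fun S hS => (hM S hS).1) fun S hS => (hM S hS).2.1)
  have hcost := ccCost_add_two_mul G P
  have hinner : #(blockPairs P ∩ G.edgeFinset) = ∑ S ∈ P.parts, #(pairsIn S ∩ G.edgeFinset) := by
    rw [blockPairs, biUnion_inter, card_biUnion]
    exact fun S hS T hT hST => disjoint_of_subset_left inter_subset_left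
      (disjoint_of_subset_right inter_subset_left (pairwiseDisjoint_pairsIn P hS hT hST))
  have hpairs : #(blockPairs P) = ∑ S ∈ P.parts, #(pairsIn S) :=
    card_biUnion fun S hS T hT hST => pairwiseDisjoint_pairsIn P hS hT hST
  have hsum : ∑ S ∈ P.parts, (#S + 4 * #(pairsIn S ∩ G.edgeFinset))
      ≤ ∑ S ∈ P.parts, (2 * #(pairsIn S) + 4 * #(M S)) := by
    refine sum_le_sum fun S hS => ?_
    have h := (hM S hS).2.2
    obtain ⟨a, ha⟩ : ∃ a, #S = 2 * a := ⟨_, ((mul_comm _ _).trans (hP S hS 0)).symm⟩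
    have hc := Nat.choose_two_right (#S)
    rw [card_pairsIn]
    rw [ha] at h hc ⊢
    rw [Nat.mul_div_cancel_left _ two_pos] at h
    rw [mul_assoc, Nat.mul_div_cancel_left _ two_pos] at hc
    rw [hc]
    rcases a with _ | b
    · simp at h ⊢
      omega
    · have : 2 * (b + 1) - 1 = 2 * b + 1 := by omega
      rw [this]
      rw [Nat.add_sub_cancel] at h
      nlinarith
  simp only [sum_add_distrib, ← mul_sum, P.sum_card_parts, card_univ] at hsum
  omega

lemma exists_balanced_ccCost_le {V : Type*} [Fintype V] [DecidableEq V] (G : SimpleGraph V)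
    [DecidableRel G.Adj] (col : V → Fin 2)
    (hratio : ∀ i : Fin 2, #{v : V | col v = i} * 2 = Fintype.card V)
    {M : Finset (Sym2 V)} (hM : IsBichromaticMatching G col M) :
    ∃ P : Finpartition (univ : Finset V),
      (∀ S ∈ P.parts, ∀ i, #{v ∈ S | col v = i} * 2 = #S) ∧
      2 * ccCost G P.parts + 4 * #M ≤ Fintype.card V + 2 * #G.edgeFinset := by
  classical
  obtain ⟨hMG, hMdisj, hMcol⟩ := hM
  have huniq {u v w : V} (hv : s(u, v) ∈ M) (hw : s(u, w) ∈ M) : v = w := by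
    by_contra h
    exact hMdisj _ hv _ hw (fun h' => h (Sym2.congr_right.1 h')) u (by simp) (by simp)
  have hne {u v : V} (h : s(u, v) ∈ M) : col u ≠ col v :=
    hMcol _ h u (by simp) v (by simp) (G.ne_of_adj (hMG h))
  have hpartner (u : {v // col v = 0}) : ∃ w, (∃ w', s(u.1, w') ∈ M) → s(u.1, w) ∈ M := by
    by_cases h : ∃ w', s(u.1, w') ∈ M
    · exact h.imp fun _ h _ => h
    · exact ⟨u, fun h' => (h h').elim⟩
  choose f hf using hpartner
  have h0 := hratio 0
  have h1 := hratio 1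
  obtain ⟨g, hg⟩ := Set.MapsTo.exists_equiv_extend_of_card_eq
    (t := ({v | col v = 1} : Finset V)) (s := {u : {v // col v = 0} | ∃ w, s(u.1, w) ∈ M}) (f := f)
    (by rw [Fintype.card_subtype]; omega)
    (fun u hu => by
      have := hne (hf u hu)
      have := u.2
      simp
      omega)
    (fun u hu v hv huv => by
      have hu' := hf u hu
      have hv' := hf v hv
      rw [← huv, Sym2.eq_swap] at hv'
      rw [Sym2.eq_swap] at hu'
      exact Subtype.ext (huniq hu' hv'))
  have hgcol (u : {v // col v = 0}) : col (g u).1 = 1 := (mem_filter.1 (g u).2).2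
  have hug (u v : {v // col v = 0}) : u.1 ≠ (g v).1 := fun h => by
    have := hgcol v
    rw [← h, u.2] at this
    omega
  let P : Finpartition (univ : Finset V) := Finpartition.ofExistsUnique
    (univ.image fun u : {v // col v = 0} => ({u.1, (g u).1} : Finset V))
    (fun _ _ => subset_univ _)
    (by
      intro v _
      obtain hv | hv : col v = 0 ∨ col v = 1 := by omega
      · refine ⟨{v, (g ⟨v, hv⟩).1}, ⟨mem_image.2 ⟨⟨v, hv⟩, mem_univ _, rfl⟩, by simp⟩, ?_⟩
        rintro T ⟨hT, hvT⟩
        obtain ⟨u, -, rfl⟩ := mem_image.1 hT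
        rcases mem_insert.1 hvT with rfl | h
        · rfl
        · exact (hug ⟨v, hv⟩ u (mem_singleton.1 h)).elim
      · obtain ⟨u, hu⟩ := g.surjective ⟨v, by simpa using hv⟩
        have hu' : (g u).1 = v := by rw [hu]
        refine ⟨{u.1, (g u).1}, ⟨mem_image.2 ⟨u, mem_univ _, rfl⟩, by simp [hu']⟩, ?_⟩
        rintro T ⟨hT, hvT⟩
        obtain ⟨w, -, rfl⟩ := mem_image.1 hT
        rcases mem_insert.1 hvT with h | h
        · exact (hug w u (h.symm.trans hu'.symm)).elim
        · obtain rfl := g.injective (Subtype.ext (hu'.trans (mem_singleton.1 h)))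
          rfl)
    (by simp)
  have hparts : P.parts = univ.image fun u : {v // col v = 0} => ({u.1, (g u).1} : Finset V) := rfl
  refine ⟨P, ?_, ?_⟩
  · intro S hS i
    obtain ⟨u, -, rfl⟩ := mem_image.1 (hparts ▸ hS)
    rw [card_pair (hug u u), filter_insert, filter_singleton, u.2, hgcol u]
    fin_cases i <;> simp
  · have hpairs : #(blockPairs P) * 2 ≤ Fintype.card V := by
      rw [← h0]
      gcongr
      calc #(blockPairs P) ≤ #P.parts * 1 := by
            refine card_biUnion_le_card_mul _ _ _ fun S hS => ?_
            obtain ⟨u, -, rfl⟩ := mem_image.1 (hparts ▸ hS)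
            rw [card_pairsIn, card_pair (hug u u), Nat.choose_self]
        _ ≤ #(univ : Finset {v // col v = 0}) := by
            rw [mul_one, hparts]
            exact card_image_le
        _ = _ := by rw [card_univ, Fintype.card_subtype]
    have hMsub : M ⊆ blockPairs P ∩ G.edgeFinset := by
      have aux {u v : V} (h : s(u, v) ∈ M) (hu : col u = 0) :
          s(u, v) ∈ blockPairs P ∩ G.edgeFinset := by
        have hv : (g ⟨u, hu⟩).1 = v :=
          (hg ⟨u, hu⟩ ⟨v, h⟩).trans (huniq (hf ⟨u, hu⟩ ⟨v, h⟩) h)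
        refine mem_inter.2 ⟨mk_mem_blockPairs.2 ⟨G.ne_of_adj (hMG h), {u, (g ⟨u, hu⟩).1}, ?_,
          by simp, by simp [hv]⟩, SimpleGraph.mem_edgeFinset.2 (hMG h)⟩
        rw [hparts]
        exact mem_image.2 ⟨⟨u, hu⟩, mem_univ _, rfl⟩
      intro e he
      induction e with | _ u v
      have hc := hne he
      obtain hu | hv : col u = 0 ∨ col v = 0 := by omega
      · exact aux he hu
      · rw [Sym2.eq_swap] at he ⊢
        exact aux he hv
    have := card_le_card hMsub
    have := ccCost_add_two_mul G P
    omega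

lemma fairSet_iff_of_ratio {V : Type*} [Fintype V] [Nonempty V] {col : V → Fin 2}
    (hratio : ∀ i : Fin 2, #{v : V | col v = i} * 2 = Fintype.card V) (S : Finset V) :
    FairSet col S ↔ ∀ i, #{v ∈ S | col v = i} * 2 = #S := by
  refine forall_congr' fun i => ?_
  have hpos : 0 < #{v : V | col v = i} := by
    have := hratio i
    have := Fintype.card_pos (α := V)
    omega
  rw [← hratio i, ← mul_assoc, mul_right_comm, mul_comm, Nat.mul_right_inj hpos.ne']

/-- For a bipartite graph with `n` vertices, `m` edges and two colors in
ratio `1:1`, if `ν` is the maximum size of a matching using only bichromatic edges, then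
the minimum correlation clustering cost over all fair partitions equals `n/2 + m - 2ν`. -/
theorem stmt6 {V : Type*} [Fintype V] [DecidableEq V]
    (G : SimpleGraph V) (A : Set V)
    (hbip : ∀ u v, G.Adj u v → (u ∈ A ↔ v ∉ A))
    (col : V → Fin 2)
    (hratio : ∀ i : Fin 2,
      (Finset.univ.filter fun v => col v = i).card * 2 = Fintype.card V)
    (ν : ℕ)
    (hν : IsGreatest {s : ℕ | ∃ M : Finset (Sym2 V),
        IsBichromaticMatching G col M ∧ M.card = s} ν) :
    IsLeast {x : ℚ | ∃ P : Finpartition (Finset.univ : Finset V),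
        (∀ S ∈ P.parts, FairSet col S) ∧ (ccCost G P.parts : ℚ) = x}
      ((Fintype.card V : ℚ) / 2 + (G.edgeSet.ncard : ℚ) - 2 * (ν : ℚ)) := by
  classical
  have hfair (P : Finpartition (univ : Finset V)) :
      (∀ S ∈ P.parts, FairSet col S) ↔
        ∀ S ∈ P.parts, ∀ i, #{v ∈ S | col v = i} * 2 = #S := by
    refine forall₂_congr fun S hS => ?_
    obtain ⟨v, -⟩ := P.nonempty_of_mem_parts hS
    have : Nonempty V := ⟨v⟩
    exact fairSet_iff_of_ratio hratio S
  have hm : G.edgeSet.ncard = #G.edgeFinset := by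
    rw [← SimpleGraph.coe_edgeFinset, Set.ncard_coe_finset]
  obtain ⟨⟨M, hM, hMν⟩, hmax⟩ := hν
  have hlower (P : Finpartition (univ : Finset V)) (hP : ∀ S ∈ P.parts, FairSet col S) :=
    card_add_two_mul_card_edges_le_ccCost G hbip col (fun M hM => hmax ⟨M, hM, rfl⟩) P
      ((hfair P).1 hP)
  rw [hm]
  constructor
  · obtain ⟨P, hP, hcost⟩ := exists_balanced_ccCost_le G col hratio hM
    rw [← hfair P] at hP
    refine ⟨P, hP, ?_⟩
    rw [hMν] at hcost
    have heq : (2 * ccCost G P.parts + 4 * ν : ℚ) = Fintype.card V + 2 * #G.edgeFinset := by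
      exact_mod_cast le_antisymm hcost (hlower P hP)
    linarith
  · rintro x ⟨P, hP, rfl⟩
    have hle : (Fintype.card V + 2 * #G.edgeFinset : ℚ) ≤ 2 * ccCost G P.parts + 4 * ν := by
      exact_mod_cast hlower P hP
    linarith
end

section
/- Let F be a forest whose vertices are colored with two colors in ratio 1:1, let 0 < α < 1, and let α̂ be the minimal positive integer such that 2α̂/α is a positive integer with 2α̂/α > 4. Then every α-relaxed fair partition of the vertices of F of minimum correlation clustering cost among all α-relaxed fair partitions has all parts of size strictly less than 4α̂/α². -/
open Finset

/-- A set `S` is `α`-relaxed fair w.r.t. the coloring `col`: for each color `i`,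
`α·|Uᵢ|/|V| ≤ |S ∩ Uᵢ|/|S| ≤ |Uᵢ|/(α·|V|)` (stated by cross multiplication). -/
def AlphaFairSet {V : Type*} [Fintype V] {k : ℕ} (α : ℚ) (col : V → Fin k)
    (S : Finset V) : Prop :=
  ∀ i : Fin k,
    α * ((Finset.univ.filter fun v => col v = i).card : ℚ) * (S.card : ℚ)
        ≤ ((S.filter fun v => col v = i).card : ℚ) * (Fintype.card V : ℚ) ∧
    α * ((S.filter fun v => col v = i).card : ℚ) * (Fintype.card V : ℚ)
        ≤ ((Finset.univ.filter fun v => col v = i).card : ℚ) * (S.card : ℚ)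

theorem SimpleGraph.IsAcyclic.ncard_edgeSet_le {V : Type*} [Finite V] {G : SimpleGraph V}
    (hG : G.IsAcyclic) : G.edgeSet.ncard ≤ Nat.card V := by
  classical
  have := Fintype.ofFinite V
  cases isEmpty_or_nonempty V
  · have h : G.edgeSet = ∅ := by
      ext e
      induction e with | _ u v => exact isEmptyElim u
    simp [h]
  · obtain ⟨T, hGT, hT⟩ := SimpleGraph.exists_maximal_isAcyclic_of_le_isAcyclic (le_top : G ≤ ⊤) hG
    have hTree : T.IsTree :=
      (SimpleGraph.connected_top.maximal_le_isAcyclic_iff_isTree hT.prop.1).1 hT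
    have hcard := hTree.card_edgeFinset
    calc G.edgeSet.ncard ≤ T.edgeSet.ncard :=
          Set.ncard_le_ncard (SimpleGraph.edgeSet_mono hGT) (Set.toFinite _)
      _ = #T.edgeFinset := by rw [← SimpleGraph.coe_edgeFinset, Set.ncard_coe_finset]
      _ ≤ Nat.card V := by rw [Nat.card_eq_fintype_card]; lia

/-- A forest has at most `#S` edges with both endpoints in `S`. -/
theorem SimpleGraph.IsAcyclic.ncard_edges_within_le {V : Type*} {G : SimpleGraph V}
    (hG : G.IsAcyclic) (S : Finset V) :
    {e ∈ G.edgeSet | ∀ u ∈ e, u ∈ S}.ncard ≤ #S := by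
  have hsub : {e ∈ G.edgeSet | ∀ u ∈ e, u ∈ S} ⊆
      Sym2.map (Subtype.val : {x // x ∈ (S : Set V)} → V) '' (G.induce (S : Set V)).edgeSet := by
    rintro e ⟨he, heS⟩
    induction e with
    | _ u v =>
      exact ⟨s(⟨u, heS u (by simp)⟩, ⟨v, heS v (by simp)⟩), he, rfl⟩
  calc _ ≤ _ := Set.ncard_le_ncard hsub (Set.toFinite _)
    _ ≤ (G.induce (S : Set V)).edgeSet.ncard := Set.ncard_image_le (Set.toFinite _)
    _ ≤ Nat.card (S : Set V) := (hG.induce _).ncard_edgeSet_le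
    _ = #S := by simp

/-- The unordered pairs with one endpoint in `A` and the other in `B`. -/
def crossPairs {V : Type*} (A B : Finset V) : Set (Sym2 V) :=
  (fun p : V × V => s(p.1, p.2)) '' (↑(A ×ˢ B) : Set (V × V))

theorem mk_mem_crossPairs {V : Type*} {A B : Finset V} {u v : V} :
    s(u, v) ∈ crossPairs A B ↔ u ∈ A ∧ v ∈ B ∨ v ∈ A ∧ u ∈ B := by
  simp only [crossPairs, Set.mem_image, coe_product, Set.mem_prod, mem_coe, Prod.exists,
    Sym2.eq_iff]
  constructor
  · rintro ⟨a, b, ⟨ha, hb⟩, ⟨rfl, rfl⟩ | ⟨rfl, rfl⟩⟩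
    · exact Or.inl ⟨ha, hb⟩
    · exact Or.inr ⟨ha, hb⟩
  · rintro (⟨ha, hb⟩ | ⟨ha, hb⟩)
    · exact ⟨u, v, ⟨ha, hb⟩, Or.inl ⟨rfl, rfl⟩⟩
    · exact ⟨v, u, ⟨ha, hb⟩, Or.inr ⟨rfl, rfl⟩⟩

theorem ncard_crossPairs {V : Type*} {A B : Finset V} (h : Disjoint A B) :
    (crossPairs A B).ncard = #A * #B := by
  rw [crossPairs, Set.InjOn.ncard_image, Set.ncard_coe_finset, card_product]
  rintro ⟨a, b⟩ hab ⟨c, d⟩ hcd heq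
  simp only [coe_product, Set.mem_prod, mem_coe] at hab hcd
  obtain ⟨rfl, rfl⟩ | ⟨rfl, rfl⟩ := Sym2.eq_iff.1 heq
  · rfl
  · exact absurd hcd.2 (Finset.disjoint_left.1 h hab.1)

/-- Splitting one part `S` of a finite partition into the nonempty sets `T` and `S \ T`. -/
def Finpartition.splitPart {V : Type*} [Fintype V] [DecidableEq V]
    (P : Finpartition (univ : Finset V)) {S T : Finset V} (hS : S ∈ P.parts) (hTS : T ⊆ S)
    (hT : T.Nonempty) (hT' : (S \ T).Nonempty) : Finpartition (univ : Finset V) :=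
  Finpartition.ofExistsUnique (insert T (insert (S \ T) (P.parts.erase S)))
    (fun _ _ => subset_univ _)
    (by
      intro a _
      obtain ⟨U, ⟨hU, haU⟩, huniq⟩ := P.existsUnique_mem (mem_univ a)
      by_cases hUS : U = S
      · subst hUS
        by_cases haT : a ∈ T
        · refine ⟨T, ⟨by simp, haT⟩, ?_⟩
          rintro W ⟨hW, haW⟩
          simp only [mem_insert, mem_erase] at hW
          grind
        · refine ⟨U \ T, ⟨by simp, by simp [haU, haT]⟩, ?_⟩
          rintro W ⟨hW, haW⟩
          simp only [mem_insert, mem_erase] at hW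
          grind
      · have haS : a ∉ S := fun haS => hUS (huniq S ⟨hS, haS⟩).symm
        refine ⟨U, ⟨by simp [hU, hUS], haU⟩, ?_⟩
        rintro W ⟨hW, haW⟩
        simp only [mem_insert, mem_erase] at hW
        grind)
    (by
      have := P.bot_notMem
      simp only [bot_eq_empty] at this
      simp [this, hT.ne_empty.symm, hT'.ne_empty.symm])

section SplitPart

variable {V : Type*} [Fintype V] [DecidableEq V] (P : Finpartition (univ : Finset V))
  {S T : Finset V} (hS : S ∈ P.parts) (hTS : T ⊆ S) (hT : T.Nonempty) (hT' : (S \ T).Nonempty)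

theorem Finpartition.mem_splitPart_parts {U : Finset V} :
    U ∈ (P.splitPart hS hTS hT hT').parts ↔ U = T ∨ U = S \ T ∨ U ≠ S ∧ U ∈ P.parts := by
  simp [Finpartition.splitPart]

theorem sameBlock_of_splitPart {u v : V}
    (h : SameBlock (P.splitPart hS hTS hT hT').parts u v) : SameBlock P.parts u v := by
  obtain ⟨U, hU, hu, hv⟩ := h
  rw [P.mem_splitPart_parts] at hU
  obtain rfl | rfl | ⟨-, hU⟩ := hU
  · exact ⟨S, hS, hTS hu, hTS hv⟩
  · exact ⟨S, hS, sdiff_subset hu, sdiff_subset hv⟩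
  · exact ⟨U, hU, hu, hv⟩

theorem not_sameBlock_splitPart {u v : V} (hu : u ∈ T) (hv : v ∈ S \ T) :
    ¬ SameBlock (P.splitPart hS hTS hT hT').parts u v := by
  rintro ⟨U, hU, hu', hv'⟩
  rw [P.mem_splitPart_parts] at hU
  obtain rfl | rfl | ⟨hne, hU⟩ := hU
  · exact (mem_sdiff.1 hv).2 hv'
  · exact (mem_sdiff.1 hu').2 hu
  · exact hne (P.eq_of_mem_parts hU hS hu' (hTS hu))

theorem sameBlock_splitPart_or {u v : V} (h : SameBlock P.parts u v) :
    SameBlock (P.splitPart hS hTS hT hT').parts u v ∨ s(u, v) ∈ crossPairs T (S \ T) := by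
  obtain ⟨U, hU, hu, hv⟩ := h
  rw [mk_mem_crossPairs]
  by_cases hUS : U = S
  · subst hUS
    by_cases huT : u ∈ T <;> by_cases hvT : v ∈ T
    · exact Or.inl ⟨T, (P.mem_splitPart_parts ..).2 (by simp), huT, hvT⟩
    · simp [huT, hv, hvT]
    · simp [hvT, hu, huT]
    · exact Or.inl ⟨U \ T, (P.mem_splitPart_parts ..).2 (by simp), by simp [hu, huT],
        by simp [hv, hvT]⟩
  · exact Or.inl ⟨U, (P.mem_splitPart_parts ..).2 (by simp [hU, hUS]), hu, hv⟩

theorem intraCost_splitPart_add_le (G : SimpleGraph V) :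
    intraCost G (P.splitPart hS hTS hT hT').parts + (crossPairs T (S \ T) \ G.edgeSet).ncard ≤
      intraCost G P.parts := by
  rw [intraCost, intraCost, ← Set.ncard_union_eq ?_ (Set.toFinite _) (Set.toFinite _)]
  · refine Set.ncard_le_ncard ?_ (Set.toFinite _)
    rintro e (⟨hd, he, h⟩ | ⟨hc, he⟩)
    · exact ⟨hd, he, fun u hu v hv => sameBlock_of_splitPart P hS hTS hT hT' (h u hu v hv)⟩
    · induction e with
      | _ u v =>
        rw [mk_mem_crossPairs] at hc
        have hu : u ∈ S := by grind
        have hv : v ∈ S := by grind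
        refine ⟨?_, he, ?_⟩
        · rw [Sym2.mk_isDiag_iff]
          rintro rfl
          grind
        · intro x hx y hy
          refine ⟨S, hS, ?_, ?_⟩
          · obtain rfl | rfl := Sym2.mem_iff.1 hx <;> assumption
          · obtain rfl | rfl := Sym2.mem_iff.1 hy <;> assumption
  · rw [Set.disjoint_left]
    rintro e ⟨-, -, h⟩ ⟨hc, -⟩
    induction e with
    | _ u v =>
      obtain ⟨hu, hv⟩ | ⟨hv, hu⟩ := mk_mem_crossPairs.1 hc
      · exact not_sameBlock_splitPart P hS hTS hT hT' hu hv (h u (by simp) v (by simp))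
      · exact not_sameBlock_splitPart P hS hTS hT hT' hv hu (h v (by simp) u (by simp))

theorem interCost_splitPart_le (G : SimpleGraph V) :
    interCost G (P.splitPart hS hTS hT hT').parts ≤
      interCost G P.parts + (crossPairs T (S \ T) ∩ G.edgeSet).ncard := by
  rw [interCost, interCost]
  refine (Set.ncard_le_ncard ?_ (Set.toFinite _)).trans (Set.ncard_union_le _ _)
  rintro e ⟨he, u, hu, v, hv, huv⟩
  by_cases h : SameBlock P.parts u v
  · have hc := (sameBlock_splitPart_or P hS hTS hT hT' h).resolve_left huv
    have hne : u ≠ v := by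
      rintro rfl
      rw [mk_mem_crossPairs] at hc
      grind
    rw [← (Sym2.mem_and_mem_iff hne).1 ⟨hu, hv⟩] at hc
    exact Or.inr ⟨hc, he⟩
  · exact Or.inl ⟨he, u, hu, v, hv, h⟩

theorem ccCost_splitPart_add_le {G : SimpleGraph V} (hG : G.IsAcyclic) :
    ccCost G (P.splitPart hS hTS hT hT').parts + #T * #(S \ T) ≤ ccCost G P.parts + 2 * #S := by
  have hintra := intraCost_splitPart_add_le P hS hTS hT hT' G
  have hinter := interCost_splitPart_le P hS hTS hT hT' G
  have hcross := ncard_crossPairs (disjoint_sdiff (s := T) (t := S))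
  have hadd := Set.ncard_inter_add_ncard_sdiff_eq_ncard (crossPairs T (S \ T)) G.edgeSet
    (Set.toFinite _)
  have hle : (crossPairs T (S \ T) ∩ G.edgeSet).ncard ≤ #S := by
    refine (Set.ncard_le_ncard ?_ (Set.toFinite _)).trans (hG.ncard_edges_within_le S)
    rintro e ⟨hc, he⟩
    refine ⟨he, ?_⟩
    induction e with
    | _ u v =>
      rw [mk_mem_crossPairs] at hc
      intro x hx
      obtain rfl | rfl := Sym2.mem_iff.1 hx <;> grind
  rw [ccCost, ccCost]
  lia

end SplitPart

/-- For two equally frequent colors, fairness amounts to the lower bound on each color. -/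
theorem alphaFairSet_iff_of_balanced {V : Type*} [Fintype V] [Nonempty V] {col : V → Fin 2}
    (hratio : ∀ i : Fin 2, #{v | col v = i} * 2 = Fintype.card V) {α : ℚ} (hα0 : 0 < α)
    (S : Finset V) :
    AlphaFairSet α col S ↔ ∀ i, α * #S ≤ 2 * #{v ∈ S | col v = i} := by
  have hn : (0 : ℚ) < Fintype.card V := by exact_mod_cast Fintype.card_pos
  have hU (i : Fin 2) : (#{v | col v = i} : ℚ) = Fintype.card V / 2 := by
    rw [← hratio i]; push_cast; ring
  have hsum (i : Fin 2) :
      (#S : ℚ) = #{v ∈ S | col v = i} + #{v ∈ S | col v = 1 - i} := by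
    have h : {v ∈ S | col v = 1 - i} = {v ∈ S | ¬ col v = i} := by
      refine filter_congr fun v _ => ?_
      generalize col v = c
      revert c i
      decide
    rw [h]
    exact_mod_cast (card_filter_add_card_filter_not (s := S) fun v => col v = i).symm
  simp only [AlphaFairSet, hU]
  constructor
  · intro h i
    have := (h i).1
    refine le_of_mul_le_mul_right ?_ hn
    linarith
  · intro h i
    have h1 := h i
    have h2 := h (1 - i)
    have h3 := hsum i
    refine ⟨by nlinarith, ?_⟩
    have key : 2 * α * #{v ∈ S | col v = i} ≤ #S := by
      have h4 := mul_le_mul_of_nonneg_left h2 hα0.le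
      have h5 : (0 : ℚ) ≤ #S := by positivity
      nlinarith [mul_nonneg h5 (sq_nonneg (1 - α))]
    nlinarith

theorem Finset.exists_subset_card_filter_eq {V : Type*} [DecidableEq V] {S : Finset V}
    {p : V → Prop} [DecidablePred p] {a b : ℕ} (ha : a ≤ #{v ∈ S | p v})
    (hb : b ≤ #{v ∈ S | ¬ p v}) :
    ∃ T ⊆ S, #{v ∈ T | p v} = a ∧ #{v ∈ T | ¬ p v} = b := by
  obtain ⟨A, hA, rfl⟩ := exists_subset_card_eq ha
  obtain ⟨B, hB, rfl⟩ := exists_subset_card_eq hb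
  refine ⟨A ∪ B, by grind, ?_, ?_⟩
  · congr 1; grind
  · congr 1; grind

/-- A sufficiently large set in which each color has share at least `α / 2` can be divided into
a set of size `2 * a / α` and its complement, both satisfying the same bound. -/
theorem exists_balanced_split {V : Type*} [DecidableEq V] {col : V → Fin 2} {α : ℚ}
    (hα1 : α < 1) {a t : ℕ} (ht : (t : ℚ) * α = 2 * a) {S : Finset V}
    (hS : ∀ i, α * #S ≤ 2 * #{v ∈ S | col v = i}) (hlarge : 2 * (t : ℚ) ≤ α * #S) :
    ∃ T ⊆ S, #T = t ∧ (∀ i, α * #T ≤ 2 * #{v ∈ T | col v = i}) ∧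
      ∀ i, α * #(S \ T) ≤ 2 * #{v ∈ S \ T | col v = i} := by
  obtain ⟨i, hi⟩ : ∃ i : Fin 2, 2 * #{v ∈ S | col v = i} ≤ #S := by
    by_contra! h
    have h0 := h 0
    have h1 := h 1
    have h2 := card_filter_add_card_filter_not (s := S) fun v => col v = 0
    have h3 : {v ∈ S | ¬ col v = 0} = {v ∈ S | col v = 1} :=
      filter_congr fun v _ => by lia
    rw [h3] at h2
    lia
  have hadd (U : Finset V) := card_filter_add_card_filter_not (s := U) fun v => col v = i
  have hat : 2 * a ≤ t := by
    have h : (2 * a : ℚ) ≤ t := by nlinarith [(Nat.cast_nonneg t : (0 : ℚ) ≤ t)]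
    exact_mod_cast h
  have hAt : t ≤ #{v ∈ S | col v = i} := by
    have h := hS i
    have : (t : ℚ) ≤ #{v ∈ S | col v = i} := by linarith
    exact_mod_cast this
  have hSadd := hadd S
  obtain ⟨T, hTS, hTA, hTB⟩ := exists_subset_card_filter_eq (S := S) (p := fun v => col v = i)
    (a := a) (b := t - a) (by lia) (by lia)
  have hTadd := hadd T
  have hT : #T = t := by lia
  have hother (U : Finset V) (j : Fin 2) (hj : j ≠ i) :
      #{v ∈ U | col v = j} = #{v ∈ U | ¬ col v = i} := by
    congr 1
    refine filter_congr fun v _ => ?_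
    lia
  have hsdiff (p : V → Prop) [DecidablePred p] :
      #{v ∈ S \ T | p v} + #{v ∈ T | p v} = #{v ∈ S | p v} := by
    rw [← card_union_of_disjoint (disjoint_filter_filter sdiff_disjoint), ← filter_union,
      sdiff_union_of_subset hTS]
  have hcard : (#(S \ T) : ℚ) = #S - t := by
    rw [← hT]
    exact cast_card_sdiff hTS
  have hA : (#{v ∈ S \ T | col v = i} : ℚ) = #{v ∈ S | col v = i} - a := by
    rw [← hsdiff fun v => col v = i, hTA]; push_cast; ring
  have htaq : ((t - a : ℕ) : ℚ) = t - a := Nat.cast_sub (by lia)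
  have hB : (#{v ∈ S \ T | ¬ col v = i} : ℚ) = #{v ∈ S | ¬ col v = i} - (t - a) := by
    rw [← hsdiff fun v => ¬ col v = i, hTB, ← htaq]; push_cast; ring
  refine ⟨T, hTS, hT, fun j => ?_, fun j => ?_⟩
  · by_cases hj : j = i
    · subst hj
      rw [hT, hTA]
      linarith
    · rw [hother T j hj, hT, hTB, htaq]
      have : (2 * a : ℚ) ≤ t := by exact_mod_cast hat
      linarith
  · by_cases hj : j = i
    · subst hj
      rw [hcard, hA]
      have := hS j
      linarith
    · rw [hother _ j hj, hcard, hB]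
      have hmaj : (#S : ℚ) ≤ 2 * #{v ∈ S | ¬ col v = i} := by
        have : #S ≤ 2 * #{v ∈ S | ¬ col v = i} := by lia
        exact_mod_cast this
      have hSt : 2 * (t : ℚ) ≤ #S := by
        nlinarith [(Nat.cast_nonneg #S : (0 : ℚ) ≤ #S)]
      have := mul_le_mul_of_nonneg_left hSt (sub_nonneg.2 hα1.le)
      linarith

/-- Let `F` be a forest with two colors in ratio `1:1`, let
`0 < α < 1`, and let `α̂` be the minimal positive integer such that `2α̂/α` is a
natural number greater than 4. Then every `α`-relaxed fair partition of minimum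
correlation clustering cost among all `α`-relaxed fair partitions has all parts of
size strictly less than `4α̂/α²`. -/
theorem stmt16 {V : Type*} [Fintype V] [DecidableEq V]
    (F : SimpleGraph V) (hF : F.IsAcyclic)
    (col : V → Fin 2)
    (hratio : ∀ i : Fin 2,
      (Finset.univ.filter fun v => col v = i).card * 2 = Fintype.card V)
    (α : ℚ) (hα0 : 0 < α) (hα1 : α < 1)
    (ah : ℕ) (hah_pos : 0 < ah)
    (hah_nat : ∃ t : ℕ, (t : ℚ) = 2 * (ah : ℚ) / α)
    (hah_gt : 4 < 2 * (ah : ℚ) / α)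
    (hah_min : ∀ b : ℕ, 0 < b → (∃ t : ℕ, (t : ℚ) = 2 * (b : ℚ) / α) →
      4 < 2 * (b : ℚ) / α → ah ≤ b)
    (P : Finpartition (Finset.univ : Finset V))
    (hfair : ∀ S ∈ P.parts, AlphaFairSet α col S)
    (hopt : ∀ Q : Finpartition (Finset.univ : Finset V),
      (∀ S ∈ Q.parts, AlphaFairSet α col S) →
      ccCost F P.parts ≤ ccCost F Q.parts) :
    ∀ S ∈ P.parts, (S.card : ℚ) < 4 * (ah : ℚ) / α ^ 2 := by
  intro S hS
  by_contra! hlarge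
  obtain ⟨t, ht⟩ := hah_nat
  rw [← ht] at hah_gt
  have ht5 : 4 < t := by exact_mod_cast hah_gt
  have htα : (t : ℚ) * α = 2 * ah := by rw [ht]; field_simp
  have hlarge' : 2 * (t : ℚ) ≤ α * #S := by
    rw [div_le_iff₀ (by positivity)] at hlarge
    refine le_of_mul_le_mul_right ?_ hα0
    linarith
  obtain ⟨x, -⟩ := P.nonempty_of_mem_parts hS
  have : Nonempty V := ⟨x⟩
  have hfair_iff := alphaFairSet_iff_of_balanced hratio hα0
  obtain ⟨T, hTS, hT, hTfair, hTfair'⟩ :=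
    exists_balanced_split hα1 htα ((hfair_iff S).1 (hfair S hS)) hlarge'
  have hSt : 2 * t < #S := by
    have : (2 * t : ℚ) < #S := by
      have : (0 : ℚ) < t := by linarith
      nlinarith [(Nat.cast_nonneg #S : (0 : ℚ) ≤ #S)]
    exact_mod_cast this
  have hcard : #(S \ T) = #S - t := by rw [card_sdiff_of_subset hTS, hT]
  have hTne : T.Nonempty := card_pos.1 (by lia)
  have hTne' : (S \ T).Nonempty := card_pos.1 (by lia)
  have hle := hopt (P.splitPart hS hTS hTne hTne') fun U hU => by
    obtain rfl | rfl | ⟨-, hU⟩ := (P.mem_splitPart_parts hS hTS hTne hTne').1 hU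
    · exact (hfair_iff _).2 hTfair
    · exact (hfair_iff _).2 hTfair'
    · exact hfair U hU
  have hcost := ccCost_splitPart_add_le P hS hTS hTne hTne' hF
  rw [hcard, hT] at hcost
  have hprod : t * (#S - t) ≤ 2 * #S := by lia
  obtain ⟨m, hm⟩ : ∃ m, #S = t + m := ⟨#S - t, by lia⟩
  rw [hm, Nat.add_sub_cancel_left] at hprod
  nlinarith
end
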